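/- Let A ∈ ℝ^{n×n} be symmetric (not necessarily PSD), let L > 0, and assume that every nonzero eigenvalue of A has magnitude at least L. Suppose S ∈ ℝ^{k×n} satisfies the subspace-embedding condition with parameter L for A. Then for every index k with λ_k(A) > 0, we have λ_k(SASᵀ) ≥ λ_k(A) − 51L. -/

import Mathlib

open Matrix

/-- The eigenvalues of a real symmetric (Hermitian) matrix listed in decreasing order;
`eigDesc A i` is the `i`-th largest eigenvalue of `A` (counted with multiplicity).
(Junk value `0` if `A` is not Hermitian.) -/
noncomputable def eigDesc {n : ℕ} (A : Matrix (Fin n) (Fin n) ℝ) : Fin n → ℝ := by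
  classical
  exact if h : A.IsHermitian then
    fun i => h.eigenvalues (Tuple.sort (fun j => -h.eigenvalues j) i)
  else fun _ => 0

/-- The span of the eigenvectors of `A` whose eigenvalues have magnitude at least `lam`. -/
noncomputable def eigSpanGE {n : ℕ} (A : Matrix (Fin n) (Fin n) ℝ) (lam : ℝ) :
    Submodule ℝ (EuclideanSpace ℝ (Fin n)) :=
  ⨆ (μ : ℝ) (_ : lam ≤ |μ|), Module.End.eigenspace (Matrix.toEuclideanLin A) μ

/-- `S` is a `(1 ± α)`-distortion subspace embedding on the subspace `W`. -/
def IsSubspaceEmbeddingOn {n k : ℕ} (S : Matrix (Fin k) (Fin n) ℝ) (α : ℝ)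
    (W : Submodule ℝ (EuclideanSpace ℝ (Fin n))) : Prop :=
  ∀ v ∈ W, (1 - α) * ‖v‖ ^ 2 ≤ ‖Matrix.toEuclideanLin S v‖ ^ 2 ∧
    ‖Matrix.toEuclideanLin S v‖ ^ 2 ≤ (1 + α) * ‖v‖ ^ 2

/-- `S` satisfies the subspace-embedding condition with parameter `L` for `A`:
for every `λ ≥ L`, `S` is a `(1 ± min(L/λ, 1/10))`-distortion subspace embedding on the
span of the eigenvectors of `A` whose eigenvalues have magnitude at least `λ`. -/
def SECondition {n k : ℕ} (S : Matrix (Fin k) (Fin n) ℝ) (A : Matrix (Fin n) (Fin n) ℝ)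
    (L : ℝ) : Prop :=
  ∀ lam : ℝ, L ≤ lam → IsSubspaceEmbeddingOn S (min (L / lam) (1 / 10)) (eigSpanGE A lam)

open scoped RealInnerProductSpace

lemma aux_quad {n : ℕ} (A : Matrix (Fin n) (Fin n) ℝ) (hA : A.IsHermitian)
    (x : EuclideanSpace ℝ (Fin n)) :
    ⟪x, Matrix.toEuclideanLin A x⟫ =
      ∑ j, hA.eigenvalues j * ⟪hA.eigenvectorBasis j, x⟫ ^ 2 := by
  rw [← hA.eigenvectorBasis.sum_inner_mul_inner]
  refine Finset.sum_congr rfl fun j _ => ?_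
  have h1 : ⟪hA.eigenvectorBasis j, Matrix.toEuclideanLin A x⟫ =
      ⟪Matrix.toEuclideanLin A (hA.eigenvectorBasis j), x⟫ :=
    ((Matrix.isSymmetric_toEuclideanLin_iff.mpr hA) _ _).symm
  have h2 : Matrix.toEuclideanLin A (hA.eigenvectorBasis j) =
      hA.eigenvalues j • hA.eigenvectorBasis j := by
    ext a
    have := congrFun (hA.mulVec_eigenvectorBasis j) a
    simpa [Matrix.toEuclideanLin_apply] using this
  rw [h1, h2, real_inner_smul_left, real_inner_comm x]
  ring

lemma aux_adj {n k : ℕ} (S : Matrix (Fin k) (Fin n) ℝ) (x : EuclideanSpace ℝ (Fin n))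
    (y : EuclideanSpace ℝ (Fin k)) :
    ⟪x, Matrix.toEuclideanLin Sᵀ y⟫ = ⟪Matrix.toEuclideanLin S x, y⟫ := by
  have : Sᵀ = Sᴴ := by ext; simp
  rw [this, Matrix.toEuclideanLin_conjTranspose_eq_adjoint, LinearMap.adjoint_inner_right]

lemma aux_form {n k : ℕ} (A : Matrix (Fin n) (Fin n) ℝ) (hA : A.IsHermitian)
    (S : Matrix (Fin k) (Fin n) ℝ) (y : EuclideanSpace ℝ (Fin k)) :
    ⟪y, Matrix.toEuclideanLin (S * A * Sᵀ) y⟫ =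
      ∑ j, hA.eigenvalues j * ⟪Matrix.toEuclideanLin S (hA.eigenvectorBasis j), y⟫ ^ 2 := by
  have h : Matrix.toEuclideanLin (S * A * Sᵀ) y =
      Matrix.toEuclideanLin S (Matrix.toEuclideanLin A (Matrix.toEuclideanLin Sᵀ y)) := by
    ext a
    simp [Matrix.toEuclideanLin_apply, Matrix.mulVec_mulVec, Matrix.mul_assoc]
  rw [h, real_inner_comm, ← aux_adj, real_inner_comm, aux_quad A hA]
  simp_rw [aux_adj]

lemma aux_mem {n : ℕ} (A : Matrix (Fin n) (Fin n) ℝ) (hA : A.IsHermitian) (m : ℝ)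
    (x : EuclideanSpace ℝ (Fin n))
    (hx : ∀ j, |hA.eigenvalues j| < m → ⟪hA.eigenvectorBasis j, x⟫ = 0) :
    x ∈ eigSpanGE A m := by
  rw [← hA.eigenvectorBasis.sum_repr' x]
  refine Submodule.sum_mem _ fun j _ => ?_
  by_cases h : |hA.eigenvalues j| < m
  · rw [hx j h, zero_smul]; exact Submodule.zero_mem _
  · apply Submodule.smul_mem
    have h2 : Matrix.toEuclideanLin A (hA.eigenvectorBasis j) =
        hA.eigenvalues j • hA.eigenvectorBasis j := by
      ext a
      have := congrFun (hA.mulVec_eigenvectorBasis j) a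
      simpa [Matrix.toEuclideanLin_apply] using this
    refine Submodule.mem_iSup_of_mem (hA.eigenvalues j)
      (Submodule.mem_iSup_of_mem (not_lt.mp h) ?_)
    rw [Module.End.mem_eigenspace_iff]
    exact h2

/-- Almost-orthogonality from a subspace embedding. -/
lemma aux_cross {n k : ℕ} (S : Matrix (Fin k) (Fin n) ℝ) (α : ℝ)
    (W : Submodule ℝ (EuclideanSpace ℝ (Fin n))) (h : IsSubspaceEmbeddingOn S α W)
    (x z : EuclideanSpace ℝ (Fin n)) (hx : x ∈ W) (hz : z ∈ W) (hxz : ⟪z, x⟫ = 0) :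
    ⟪Matrix.toEuclideanLin S z, Matrix.toEuclideanLin S x⟫ ≤ α * ‖z‖ * ‖x‖ := by
  by_cases hx0 : x = 0
  · simp [hx0]
  by_cases hz0 : z = 0
  · simp [hz0]
  have hxp : 0 < ‖x‖ := norm_pos_iff.mpr hx0
  have hzp : 0 < ‖z‖ := norm_pos_iff.mpr hz0
  have h1 := (h (‖x‖ • z + ‖z‖ • x) (W.add_mem (W.smul_mem _ hz) (W.smul_mem _ hx))).2
  have h2 := (h (‖x‖ • z - ‖z‖ • x) (W.sub_mem (W.smul_mem _ hz) (W.smul_mem _ hx))).1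
  rw [map_add, map_smul, map_smul] at h1
  rw [map_sub, map_smul, map_smul] at h2
  rw [norm_add_sq_real, norm_add_sq_real] at h1
  rw [norm_sub_sq_real, norm_sub_sq_real] at h2
  simp only [real_inner_smul_left, real_inner_smul_right, hxz, norm_smul, norm_norm] at h1 h2
  have h3 : (‖x‖ * ‖z‖) * ⟪Matrix.toEuclideanLin S z, Matrix.toEuclideanLin S x⟫ ≤
      (‖x‖ * ‖z‖) * (α * ‖z‖ * ‖x‖) := by nlinarith
  exact le_of_mul_le_mul_left h3 (by positivity)

/-- Dyadic summation. -/
lemma aux_dyadic {ι : Type*} (Q : Finset ι) (l a : ι → ℝ) (L X : ℝ) (hL : 0 < L)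
    (hlow : ∀ j ∈ Q, L ≤ l j)
    (htail : ∀ m, L ≤ m → ∑ j ∈ Q with m ≤ l j, a j ^ 2 ≤ (L / m) ^ 2 * X) (hX : 0 ≤ X) :
    ∑ j ∈ Q, l j * a j ^ 2 ≤ 4 * L * X := by
  classical
  have key : ∀ M : ℕ, ∑ j ∈ Q with l j < 2 ^ M * L, l j * a j ^ 2 ≤
      4 * L * (1 - (1 / 2) ^ M) * X := by
    intro M
    induction M with
    | zero =>
      rw [Finset.filter_false_of_mem]
      · simp
      · intro j hj
        simpa using hlow j hj
    | succ M ih =>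
      have hsub : (Q.filter fun j => l j < 2 ^ (M + 1) * L) ⊆
          (Q.filter fun j => l j < 2 ^ M * L) ∪
            (Q.filter fun j => 2 ^ M * L ≤ l j).filter fun j => l j < 2 ^ (M + 1) * L := by
        intro j hj
        simp only [Finset.mem_filter, Finset.mem_union] at hj ⊢
        rcases lt_or_ge (l j) (2 ^ M * L) with h | h
        · exact Or.inl ⟨hj.1, h⟩
        · exact Or.inr ⟨⟨hj.1, h⟩, hj.2⟩
      have hnn : ∀ j ∈ Q, 0 ≤ l j * a j ^ 2 := fun j hj =>
        mul_nonneg (hL.le.trans (hlow j hj)) (sq_nonneg _)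
      have h1 : ∑ j ∈ (Q.filter fun j => 2 ^ M * L ≤ l j) with l j < 2 ^ (M + 1) * L,
          l j * a j ^ 2 ≤ 2 ^ (M + 1) * L * ((1 / 2) ^ M) ^ 2 * X := by
        calc _ ≤ ∑ j ∈ (Q.filter fun j => 2 ^ M * L ≤ l j) with l j < 2 ^ (M + 1) * L,
              2 ^ (M + 1) * L * a j ^ 2 := by
              refine Finset.sum_le_sum fun j hj => ?_
              exact mul_le_mul_of_nonneg_right (Finset.mem_filter.mp hj).2.le (sq_nonneg _)
          _ ≤ ∑ j ∈ Q with 2 ^ M * L ≤ l j, 2 ^ (M + 1) * L * a j ^ 2 :=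
              Finset.sum_le_sum_of_subset_of_nonneg (Finset.filter_subset _ _)
                fun j _ _ => by positivity
          _ = 2 ^ (M + 1) * L * ∑ j ∈ Q with 2 ^ M * L ≤ l j, a j ^ 2 := by
              rw [Finset.mul_sum]
          _ ≤ 2 ^ (M + 1) * L * ((L / (2 ^ M * L)) ^ 2 * X) := by
              refine mul_le_mul_of_nonneg_left (htail _ ?_) (by positivity)
              exact le_mul_of_one_le_left hL.le (one_le_pow₀ (by norm_num))
          _ = _ := by
              have : L / (2 ^ M * L) = (1 / 2) ^ M := by
                rw [one_div, inv_pow]; field_simp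
              rw [this]; ring
      have h2 : (2 : ℝ) ^ (M + 1) * ((1 / 2) ^ M) ^ 2 = 2 * (1 / 2) ^ M := by
        rw [one_div, inv_pow]; field_simp
        ring
      calc _ ≤ _ := Finset.sum_le_sum_of_subset_of_nonneg hsub (by
                intro j hj _
                simp only [Finset.mem_filter, Finset.mem_union] at hj
                exact hnn j (by tauto))
        _ ≤ (∑ j ∈ Q with l j < 2 ^ M * L, l j * a j ^ 2) +
            ∑ j ∈ (Q.filter fun j => 2 ^ M * L ≤ l j) with l j < 2 ^ (M + 1) * L,
              l j * a j ^ 2 := by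
            rw [← Finset.sum_union_inter]
            refine le_add_of_nonneg_right (Finset.sum_nonneg fun j hj => ?_)
            simp only [Finset.mem_filter, Finset.mem_inter] at hj
            exact hnn j (by tauto)
        _ ≤ 4 * L * (1 - (1 / 2) ^ M) * X + 2 ^ (M + 1) * L * ((1 / 2) ^ M) ^ 2 * X :=
            add_le_add ih h1
        _ = 4 * L * (1 - (1 / 2) ^ M) * X + 2 ^ (M + 1) * ((1 / 2) ^ M) ^ 2 * L * X := by ring
        _ = _ := by rw [h2]; ring
  obtain ⟨b, hb⟩ := (Q.image l).bddAbove
  obtain ⟨M, hM⟩ := pow_unbounded_of_one_lt (b / L) (by norm_num : (1 : ℝ) < 2)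
  have h := key M
  rw [Finset.filter_true_of_mem] at h
  · refine h.trans ?_
    have : (0 : ℝ) ≤ (1 / 2) ^ M := by positivity
    have h4 : 0 ≤ 4 * L * X := by positivity
    nlinarith
  · intro j hj
    refine lt_of_le_of_lt (hb (Finset.mem_coe.mpr (Finset.mem_image_of_mem l hj))) ?_
    rwa [div_lt_iff₀ hL] at hM

lemma aux_eigDesc {n : ℕ} (A : Matrix (Fin n) (Fin n) ℝ) (hA : A.IsHermitian) :
    ∃ σ : Equiv.Perm (Fin n), (∀ i, eigDesc A i = hA.eigenvalues (σ i)) ∧ Antitone (eigDesc A) := by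
  refine ⟨Tuple.sort (fun j => -hA.eigenvalues j), ?_, ?_⟩
  · intro i
    simp only [eigDesc, hA, dif_pos]
  · intro a b hab
    have := Tuple.monotone_sort (fun j => -hA.eigenvalues j) hab
    simp only [Function.comp] at this
    simp only [eigDesc, hA, dif_pos]
    linarith

/-- The core lower bound on the quadratic form. -/
lemma aux_core {n k : ℕ} (A : Matrix (Fin n) (Fin n) ℝ) (hA : A.IsHermitian)
    (S : Matrix (Fin k) (Fin n) ℝ) (L : ℝ) (hL : 0 < L)
    (heig : ∀ i : Fin n, hA.eigenvalues i ≠ 0 → L ≤ |hA.eigenvalues i|)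
    (hS : SECondition S A L) (t : ℝ) (ht : L ≤ t) (x : EuclideanSpace ℝ (Fin n))
    (hx : ∀ j, |hA.eigenvalues j| < t → ⟪hA.eigenvectorBasis j, x⟫ = 0)
    (hc : ∀ j, hA.eigenvalues j ≤ -t →
      ⟪Matrix.toEuclideanLin S (hA.eigenvectorBasis j), Matrix.toEuclideanLin S x⟫ = 0) :
    9 / 10 * ‖x‖ ^ 2 ≤ ‖Matrix.toEuclideanLin S x‖ ^ 2 ∧
    (t - 51 * L) * ‖Matrix.toEuclideanLin S x‖ ^ 2 ≤
      ⟪Matrix.toEuclideanLin S x,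
        Matrix.toEuclideanLin (S * A * Sᵀ) (Matrix.toEuclideanLin S x)⟫ := by
  classical
  have htp : 0 < t := hL.trans_le ht
  set T := Matrix.toEuclideanLin S with hT
  set u := hA.eigenvectorBasis with hu
  set l := hA.eigenvalues with hl
  set a : Fin n → ℝ := fun j => ⟪T (u j), T x⟫ with ha
  have hlow := (hS t ht x (aux_mem A hA t x hx)).1
  rw [← hT] at hlow
  have hmin1 : min (L / t) (1 / 10) ≤ L / t := min_le_left _ _
  have hmin2 : min (L / t) (1 / 10) ≤ 1 / 10 := min_le_right _ _
  have hlow1 : (1 - L / t) * ‖x‖ ^ 2 ≤ ‖T x‖ ^ 2 :=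
    le_trans (mul_le_mul_of_nonneg_right (by linarith) (sq_nonneg _)) hlow
  have hlow2 : 9 / 10 * ‖x‖ ^ 2 ≤ ‖T x‖ ^ 2 :=
    le_trans (mul_le_mul_of_nonneg_right (by linarith) (sq_nonneg _)) hlow
  refine ⟨hlow2, ?_⟩
  rw [aux_form A hA S]
  -- the three index ranges
  set P := Finset.univ.filter fun j => t ≤ l j with hP
  set Q := Finset.univ.filter fun j => l j < 0 ∧ -t < l j with hQ
  have hTz : ∀ (s : Finset (Fin n)) (b : Fin n → ℝ),
      ⟪T (∑ j ∈ s, b j • u j), T x⟫ = ∑ j ∈ s, b j * a j := by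
    intro s b
    rw [map_sum, sum_inner]
    refine Finset.sum_congr rfl fun j _ => ?_
    rw [map_smul, real_inner_smul_left]
  have hnz : ∀ (s : Finset (Fin n)) (b : Fin n → ℝ),
      ‖∑ j ∈ s, b j • u j‖ ^ 2 = ∑ j ∈ s, b j ^ 2 := by
    intro s b
    rw [← real_inner_self_eq_norm_sq, u.orthonormal.inner_sum]
    refine Finset.sum_congr rfl fun j _ => ?_
    simp [sq]
  set C := ∑ j ∈ P, a j ^ 2 with hC
  -- lower bound on C
  have hCx : (‖T x‖ ^ 2) ^ 2 ≤ ‖x‖ ^ 2 * C := by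
    have h1 : ‖T x‖ ^ 2 = ∑ j ∈ P, ⟪u j, x⟫ * a j := by
      rw [← real_inner_self_eq_norm_sq]
      have h := hTz Finset.univ (fun j => ⟪u j, x⟫)
      rw [u.sum_repr' x] at h
      rw [h]
      symm
      apply Finset.sum_subset (Finset.subset_univ _)
      intro j _ hj
      have hj' : l j < t := by simpa [hP] using hj
      by_cases hj2 : l j ≤ -t
      · rw [show a j = 0 from hc j hj2, mul_zero]
      · rw [hx j (abs_lt.mpr ⟨by linarith, hj'⟩), zero_mul]
    have h2 : ∑ j ∈ P, ⟪u j, x⟫ ^ 2 ≤ ‖x‖ ^ 2 := by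
      rw [← u.sum_sq_inner_right x]
      exact Finset.sum_le_sum_of_subset_of_nonneg (Finset.subset_univ _)
        fun j _ _ => sq_nonneg _
    rw [h1]
    refine (Finset.sum_mul_sq_le_sq_mul_sq P _ _).trans ?_
    exact mul_le_mul_of_nonneg_right h2 (Finset.sum_nonneg fun j _ => sq_nonneg _)
  have hC0 : 0 ≤ C := Finset.sum_nonneg fun j _ => sq_nonneg _
  have hLt0 : 0 ≤ 1 - L / t := by
    have : L / t ≤ 1 := (div_le_one htp).mpr ht
    linarith
  have hClow : (1 - L / t) * ‖T x‖ ^ 2 ≤ C := by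
    by_cases hx0 : x = 0
    · rw [hx0]; simpa using hC0
    have hxp : 0 < ‖x‖ ^ 2 := by have := norm_pos_iff.mpr hx0; positivity
    have : ‖x‖ ^ 2 * ((1 - L / t) * ‖T x‖ ^ 2) ≤ ‖x‖ ^ 2 * C := by
      nlinarith [mul_le_mul_of_nonneg_right hlow1 (sq_nonneg ‖T x‖)]
    exact le_of_mul_le_mul_left this hxp
  -- negative small eigenvalues
  have hneg : ∑ j ∈ Q, (-l j) * a j ^ 2 ≤ 4 * L * ‖x‖ ^ 2 := by
    refine aux_dyadic Q (fun j => -l j) a L (‖x‖ ^ 2) hL ?_ ?_ (sq_nonneg _)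
    · intro j hj
      have hj' : l j < 0 ∧ -t < l j := by simpa [hQ] using hj
      have := heig j hj'.1.ne
      rwa [abs_of_neg hj'.1] at this
    · intro m hm
      set R := Q.filter fun j => m ≤ -l j with hR
      by_cases hmt : t < m
      · have : R = ∅ := by
          apply Finset.filter_false_of_mem
          intro j hj
          have hj' : l j < 0 ∧ -t < l j := by simpa [hQ] using hj
          linarith [hj'.2]
        rw [this]
        simp only [Finset.sum_empty]; positivity
      push Not at hmt
      have hRl : ∀ j ∈ R, -t < l j ∧ m ≤ -l j ∧ l j < 0 := by
        intro j hj
        have := hj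
        simp only [hR, hQ, Finset.mem_filter, Finset.mem_univ, true_and] at this
        tauto
      set z := ∑ j ∈ R, a j • u j with hz
      have hzi : ∀ j, j ∉ R → ⟪u j, z⟫ = 0 := by
        intro j hj
        rw [hz, inner_sum]
        refine Finset.sum_eq_zero fun q hq => ?_
        rw [real_inner_smul_right, u.inner_eq_zero (by rintro rfl; exact hj hq), mul_zero]
      have hzm : z ∈ eigSpanGE A m := by
        apply aux_mem A hA
        intro j hj
        apply hzi
        intro hjR
        have h := hRl j hjR
        rw [← hl, abs_of_neg h.2.2] at hj
        linarith [h.2.1]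
      have hxm : x ∈ eigSpanGE A m := by
        apply aux_mem A hA
        intro j hj
        exact hx j (hj.trans_le hmt)
      have hzx : ⟪z, x⟫ = 0 := by
        rw [hz, sum_inner]
        refine Finset.sum_eq_zero fun q hq => ?_
        have h := hRl q hq
        rw [real_inner_smul_left, hx q (abs_lt.mpr ⟨h.1, by linarith [h.2.2]⟩), mul_zero]
      have hcr := aux_cross S _ _ (hS m hm) x z hxm hzm hzx
      rw [← hT, hz, hTz R a, ← hz] at hcr
      have hcr2 : ∑ j ∈ R, a j * a j ≤ L / m * ‖z‖ * ‖x‖ := by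
        refine hcr.trans ?_
        gcongr
        exact min_le_left _ _
      have hzn : ‖z‖ ^ 2 = ∑ j ∈ R, a j ^ 2 := hnz R a
      have hzz : ‖z‖ * ‖z‖ ≤ (L / m * ‖x‖) * ‖z‖ := by
        rw [← sq, hzn]
        simp_rw [sq]
        linarith [hcr2]
      have hmp : 0 < m := hL.trans_le hm
      rw [← hzn, ← mul_pow]
      apply pow_le_pow_left₀ (norm_nonneg _)
      by_cases hz0 : ‖z‖ = 0
      · rw [hz0]; positivity
      · exact le_of_mul_le_mul_right hzz (lt_of_le_of_ne (norm_nonneg _) (Ne.symm hz0))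
  -- combine
  have hform : t * C - 4 * L * ‖x‖ ^ 2 ≤ ∑ j, l j * a j ^ 2 := by
    have h1 : t * C ≤ ∑ j ∈ P, l j * a j ^ 2 := by
      rw [hC, Finset.mul_sum]
      refine Finset.sum_le_sum fun j hj => ?_
      exact mul_le_mul_of_nonneg_right (Finset.mem_filter.mp hj).2 (sq_nonneg _)
    have h2 : ∑ j ∈ P, l j * a j ^ 2 - ∑ j ∈ Q, (-l j) * a j ^ 2 ≤ ∑ j, l j * a j ^ 2 := by
      rw [hP, hQ, Finset.sum_filter, Finset.sum_filter, ← Finset.sum_sub_distrib]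
      refine Finset.sum_le_sum fun j _ => ?_
      by_cases c1 : t ≤ l j
      · rw [if_pos c1, if_neg (by intro h; linarith [h.1])]; simp
      · rw [if_neg c1]
        by_cases c2 : l j < 0
        · by_cases c3 : -t < l j
          · rw [if_pos ⟨c2, c3⟩]; linarith
          · rw [if_neg (fun h => c3 h.2), show a j = 0 from hc j (not_lt.mp c3)]; simp
        · rw [if_neg (fun h => c2 h.1)]
          have := mul_nonneg (not_lt.mp c2) (sq_nonneg (a j))
          linarith
    linarith
  refine le_trans ?_ hform
  have h5 : (t - L) * ‖T x‖ ^ 2 ≤ t * C := by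
    have := mul_le_mul_of_nonneg_left hClow htp.le
    have e : t * ((1 - L / t) * ‖T x‖ ^ 2) = (t - L) * ‖T x‖ ^ 2 := by
      field_simp
    linarith
  have h6 : L * (9 / 10 * ‖x‖ ^ 2) ≤ L * ‖T x‖ ^ 2 := mul_le_mul_of_nonneg_left hlow2 hL.le
  have h7 : 0 ≤ L * ‖T x‖ ^ 2 := by positivity
  nlinarith

/-- lower bound on the positive eigenvalues of `SASᵀ`. -/
theorem stmt7 {n k : ℕ} (A : Matrix (Fin n) (Fin n) ℝ) (hA : A.IsHermitian)
    (S : Matrix (Fin k) (Fin n) ℝ) (L : ℝ) (hL : 0 < L)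
    (heig : ∀ i : Fin n, hA.eigenvalues i ≠ 0 → L ≤ |hA.eigenvalues i|)
    (hS : SECondition S A L) :
    ∀ (i : ℕ) (hin : i < n) (hik : i < k), 0 < eigDesc A ⟨i, hin⟩ →
      eigDesc A ⟨i, hin⟩ - 51 * L ≤ eigDesc (S * A * Sᵀ) ⟨i, hik⟩ := by
  classical
  intro i hin hik hpos
  have hM : (S * A * Sᵀ).IsHermitian := by
    have := Matrix.isHermitian_mul_mul_conjTranspose S hA
    rwa [show Sᴴ = Sᵀ by ext; simp] at this
  obtain ⟨σ, hσ, hσa⟩ := aux_eigDesc A hA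
  obtain ⟨τ, hτ, hτa⟩ := aux_eigDesc (S * A * Sᵀ) hM
  set t := eigDesc A ⟨i, hin⟩ with ht
  have htL : L ≤ t := by
    have h := heig (σ ⟨i, hin⟩)
    rw [← hσ, ← ht, abs_of_pos hpos] at h
    exact h hpos.ne'
  set T := Matrix.toEuclideanLin S with hT
  -- top indices
  let e : Fin (i + 1) → Fin n := fun j => σ ⟨j, by omega⟩
  have he : Function.Injective e := by
    intro p q h
    have := σ.injective h
    simpa [Fin.ext_iff] using this
  set P : Finset (Fin n) := Finset.univ.filter fun j => t ≤ hA.eigenvalues j with hP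
  have hPc : i + 1 ≤ P.card := by
    have h1 : (Finset.univ.image e).card = i + 1 := by
      rw [Finset.card_image_of_injective _ he]; simp
    rw [← h1]
    apply Finset.card_le_card
    intro j hj
    obtain ⟨p, -, rfl⟩ := Finset.mem_image.mp hj
    simp only [hP, Finset.mem_filter, Finset.mem_univ, true_and]
    rw [← hσ]
    apply hσa
    rw [Fin.mk_le_mk]; omega
  let g : Fin n → EuclideanSpace ℝ (Fin n) →ₗ[ℝ] ℝ := fun j =>
    if hA.eigenvalues j ≤ -t then (innerₛₗ ℝ (T (hA.eigenvectorBasis j))) ∘ₗ T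
    else innerₛₗ ℝ (hA.eigenvectorBasis j)
  let f : EuclideanSpace ℝ (Fin n) →ₗ[ℝ] ((↥(Pᶜ) → ℝ) × (Fin i → ℝ)) :=
    LinearMap.prod (LinearMap.pi fun j => g j.1)
      (LinearMap.pi fun j : Fin i =>
        (innerₛₗ ℝ (hM.eigenvectorBasis (τ ⟨j, by omega⟩))) ∘ₗ T)
  have hker : LinearMap.ker f ≠ ⊥ := by
    apply LinearMap.ker_ne_bot_of_finrank_lt
    have := Finset.card_compl_add_card P
    simp only [Module.finrank_prod, Module.finrank_fintype_fun_eq_card, Fintype.card_coe,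
      Fintype.card_fin, finrank_euclideanSpace] at this ⊢
    omega
  obtain ⟨x, hxk, hx0⟩ := Submodule.exists_mem_ne_zero_of_ne_bot hker
  have hf : f x = 0 := hxk
  have hf1 : ∀ j, j ∉ P → g j x = 0 := fun j hj =>
    congrFun (congrArg Prod.fst hf) ⟨j, Finset.mem_compl.mpr hj⟩
  have hf2 : ∀ j : Fin i, ⟪hM.eigenvectorBasis (τ ⟨j, by omega⟩), T x⟫ = 0 := fun j =>
    congrFun (congrArg Prod.snd hf) j
  obtain ⟨hlow, hform⟩ := aux_core A hA S L hL heig hS t htL x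
    (by
      intro j hj
      rw [abs_lt] at hj
      have := hf1 j (by simp [hP, hj.2])
      simp only [g] at this
      rw [if_neg (not_le.mpr hj.1)] at this
      exact this)
    (by
      intro j hj
      have := hf1 j (by simp only [hP, Finset.mem_filter, Finset.mem_univ, true_and]; linarith)
      simp only [g] at this
      rw [if_pos hj] at this
      exact this)
  rw [← hT] at hlow hform
  have hTx : 0 < ‖T x‖ ^ 2 := by
    have := norm_pos_iff.mpr hx0
    have : 0 < ‖x‖ ^ 2 := by positivity
    linarith
  have hup : ⟪T x, Matrix.toEuclideanLin (S * A * Sᵀ) (T x)⟫ ≤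
      eigDesc (S * A * Sᵀ) ⟨i, hik⟩ * ‖T x‖ ^ 2 := by
    rw [aux_quad _ hM, ← hM.eigenvectorBasis.sum_sq_inner_right (T x), Finset.mul_sum]
    refine Finset.sum_le_sum fun j _ => ?_
    obtain ⟨q, rfl⟩ := τ.surjective j
    by_cases hq : q.1 < i
    · rw [hf2 ⟨q.1, hq⟩]; simp
    · refine mul_le_mul_of_nonneg_right ?_ (sq_nonneg _)
      rw [← hτ]
      apply hτa
      rw [Fin.le_def]; simpa using hq
  exact le_of_mul_le_mul_right (hform.trans hup) hTx
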